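/- arXiv:2605.28314 — 7 statements merged into one kernel-verified Lean document; each statement's English description precedes it below -/
import Mathlib

section
/- The octonions form an alternative algebra: for all octonions x and y (modeled as Cayley–Dickson pairs of quaternions), x*(x*y) = (x*x)*y, (x*y)*y = x*(y*y), and (x*y)*x = x*(y*x). -/
noncomputable section

/-- The quaternions over ℝ. -/
abbrev ℍ := Quaternion ℝ

/-- The octonions, modeled as Cayley–Dickson pairs of quaternions. -/
abbrev 𝕆 := ℍ × ℍ

/-- Cayley–Dickson multiplication on 𝕆 = ℍ × ℍ. -/
def omul (x y : 𝕆) : 𝕆 :=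
  (x.1 * y.1 - star y.2 * x.2, x.2 * star y.1 + y.2 * x.1)

/-- Octonionic conjugation on 𝕆 = ℍ × ℍ. -/
def oconj (x : 𝕆) : 𝕆 := (star x.1, -x.2)


/-- The octonions form an alternative algebra: the left and right alternative laws
and the flexible law hold. -/
theorem octonion_alternative (x y : 𝕆) :
    omul x (omul x y) = omul (omul x x) y ∧
    omul (omul x y) y = omul x (omul y y) ∧
    omul (omul x y) x = omul x (omul y x) := by
  refine ⟨?_, ?_, ?_⟩ <;> ext <;>
    simp only [omul,
      Quaternion.re_mul, Quaternion.imI_mul, Quaternion.imJ_mul, Quaternion.imK_mul,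
      Quaternion.re_add, Quaternion.imI_add, Quaternion.imJ_add, Quaternion.imK_add,
      Quaternion.re_sub, Quaternion.imI_sub, Quaternion.imJ_sub, Quaternion.imK_sub,
      Quaternion.re_star, Quaternion.imI_star, Quaternion.imJ_star, Quaternion.imK_star] <;>
    ring
end
end

section
/- The octonionic norm is multiplicative (Degen's eight-square identity): for all quaternions a, b, c, d, one has ‖a*c − (star d)*b‖² + ‖b*(star c) + d*a‖² = (‖a‖² + ‖b‖²)·(‖c‖² + ‖d‖²), i.e. the Euclidean norm N(a,b) := √(‖a‖² + ‖b‖²) on 𝕆 = ℍ × ℍ satisfies N(x*y) = N(x)·N(y). -/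
noncomputable section

/-- The Euclidean norm on 𝕆 = ℍ × ℍ. -/
def onorm (x : 𝕆) : ℝ := Real.sqrt (‖x.1‖ ^ 2 + ‖x.2‖ ^ 2)

/-- The octonionic norm is multiplicative (Degen's eight-square identity):
explicitly in quaternionic coordinates, and equivalently `N (x*y) = N x * N y`. -/
theorem octonion_norm_mul :
    (∀ a b c d : ℍ,
      ‖a * c - star d * b‖ ^ 2 + ‖b * star c + d * a‖ ^ 2 =
        (‖a‖ ^ 2 + ‖b‖ ^ 2) * (‖c‖ ^ 2 + ‖d‖ ^ 2)) ∧
    ∀ x y : 𝕆, onorm (omul x y) = onorm x * onorm y := by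
  have eight_square (a b c d : ℍ) :
      ‖a * c - star d * b‖ ^ 2 + ‖b * star c + d * a‖ ^ 2 =
        (‖a‖ ^ 2 + ‖b‖ ^ 2) * (‖c‖ ^ 2 + ‖d‖ ^ 2) := by
    simp only [sq ‖_‖, ← Quaternion.normSq_eq_norm_mul_self, Quaternion.normSq_def',
      Quaternion.re_sub, Quaternion.imI_sub, Quaternion.imJ_sub, Quaternion.imK_sub,
      Quaternion.re_add, Quaternion.imI_add, Quaternion.imJ_add, Quaternion.imK_add,
      Quaternion.re_mul, Quaternion.imI_mul, Quaternion.imJ_mul, Quaternion.imK_mul,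
      Quaternion.re_star, Quaternion.imI_star, Quaternion.imJ_star, Quaternion.imK_star]
    ring
  refine ⟨eight_square, fun x y => ?_⟩
  simp only [onorm, omul]
  rw [eight_square, Real.sqrt_mul (by positivity)]
end
end

section
/- The octonion algebra is a division algebra: for every octonion x ≠ 0 (modeled as a Cayley–Dickson pair of quaternions), the element x⁻¹ := (N x)⁻¹ • conj(x), where N(a,b) := ‖a‖² + ‖b‖², satisfies x * x⁻¹ = 1 and x⁻¹ * x = 1. -/
noncomputable section

/-- The unit octonion. -/
def oone : 𝕆 := (1, 0)

/-- The squared Euclidean norm on 𝕆 = ℍ × ℍ. -/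
def N (x : 𝕆) : ℝ := ‖x.1‖ ^ 2 + ‖x.2‖ ^ 2

/-- The inverse of a nonzero octonion. -/
def oinv (x : 𝕆) : 𝕆 := (N x)⁻¹ • oconj x

/-- Multiplication by the conjugate on the right gives the squared norm. -/
theorem omul_oconj (x : 𝕆) : omul x (oconj x) = N x • oone := by
  ext1
  · simp [omul, oconj, oone, N, Quaternion.self_mul_star, Quaternion.star_mul_self,
      Quaternion.normSq_eq_norm_mul_self, sq, Algebra.smul_def]
  · simp [omul, oconj, oone]

/-- Multiplication by the conjugate on the left gives the squared norm. -/
theorem oconj_omul (x : 𝕆) : omul (oconj x) x = N x • oone := by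
  ext1
  · simp [omul, oconj, oone, N, Quaternion.star_mul_self,
      Quaternion.normSq_eq_norm_mul_self, sq, Algebra.smul_def]
  · simp [omul, oconj, oone]

theorem omul_smul (r : ℝ) (x y : 𝕆) : omul x (r • y) = r • omul x y := by
  simp [omul, smul_sub, smul_add]

theorem smul_omul (r : ℝ) (x y : 𝕆) : omul (r • x) y = r • omul x y := by
  simp [omul, smul_sub, smul_add]

theorem N_ne_zero {x : 𝕆} (hx : x ≠ 0) : N x ≠ 0 := by
  contrapose! hx
  have h := (add_eq_zero_iff_of_nonneg (sq_nonneg ‖x.1‖) (sq_nonneg ‖x.2‖)).1 hx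
  exact Prod.ext (by simpa using h.1) (by simpa using h.2)

/-- The octonions form a division algebra: every nonzero octonion has a
two-sided multiplicative inverse given by `(N x)⁻¹ • conj x`. -/
theorem octonion_div_algebra (x : 𝕆) (hx : x ≠ 0) :
    omul x (oinv x) = oone ∧ omul (oinv x) x = oone := by
  have h := N_ne_zero hx
  constructor
  · rw [oinv, omul_smul, omul_oconj, inv_smul_smul₀ h]
  · rw [oinv, smul_omul, oconj_omul, inv_smul_smul₀ h]
end
end

section
/- The complexified octonions are alternative with respect to octonionic coefficients: for every octonion x ∈ 𝕆 and every complexified octonion z ∈ 𝕆_ℂ, one has ι(x) • (ι(x) • z) = ι(x*x) • z and (z • ι(x)) • ι(x) = z • ι(x*x), where ι(x) := (x, 0) is the canonical embedding 𝕆 → 𝕆_ℂ. -/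
noncomputable section

/-- The complexified octonions 𝕆_ℂ, modeled as pairs `(x, y)` standing for `x + i·y`. -/
abbrev 𝕆ℂ := 𝕆 × 𝕆

/-- Multiplication in 𝕆_ℂ. -/
def cmul (z w : 𝕆ℂ) : 𝕆ℂ :=
  (omul z.1 w.1 - omul z.2 w.2, omul z.1 w.2 + omul z.2 w.1)

/-- The canonical embedding 𝕆 → 𝕆_ℂ. -/
def ι (x : 𝕆) : 𝕆ℂ := (x, 0)

theorem quaternion_add_star_mul_comm (a q : ℍ) : (a + star a) * q = q * (a + star a) := by
  rw [Quaternion.self_add_star']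
  exact Quaternion.coe_commutes _ _

theorem quaternion_star_mul_self_comm (b q : ℍ) : star b * b * q = q * (star b * b) := by
  rw [Quaternion.star_mul_self]
  exact Quaternion.coe_commutes _ _

theorem quaternion_mul_star_self_comm (b q : ℍ) : b * star b * q = q * (star b * b) := by
  rw [Quaternion.self_mul_star, Quaternion.star_mul_self]
  exact Quaternion.coe_commutes _ _

/-- The octonions are left alternative. -/
theorem omul_omul_self_left (x y : 𝕆) : omul x (omul x y) = omul (omul x x) y := by
  obtain ⟨a, b⟩ := x
  obtain ⟨c, d⟩ := y
  simp only [omul, Prod.mk.injEq, star_add, star_sub, star_mul, star_star]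
  constructor
  · linear_combination (norm := noncomm_ring)
      quaternion_star_mul_self_comm b c - quaternion_add_star_mul_comm a (star d * b)
  · linear_combination (norm := noncomm_ring)
      -b * quaternion_add_star_mul_comm a (star c) - quaternion_mul_star_self_comm b d

/-- The octonions are right alternative. -/
theorem omul_omul_self_right (x y : 𝕆) : omul (omul y x) x = omul y (omul x x) := by
  obtain ⟨a, b⟩ := x
  obtain ⟨c, d⟩ := y
  simp only [omul, Prod.mk.injEq, star_add, star_sub, star_mul, star_star]
  constructor
  · linear_combination (norm := noncomm_ring)
      quaternion_add_star_mul_comm a (star b * d) - quaternion_star_mul_self_comm b c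
  · linear_combination (norm := noncomm_ring)
      -b * quaternion_add_star_mul_comm a c - quaternion_mul_star_self_comm b d

theorem omul_zero (x : 𝕆) : omul x 0 = 0 := by
  simp [omul]

theorem zero_omul (x : 𝕆) : omul 0 x = 0 := by
  simp [omul]

theorem ι_cmul (x : 𝕆) (z : 𝕆ℂ) : cmul (ι x) z = (omul x z.1, omul x z.2) := by
  simp [cmul, ι, zero_omul]

theorem cmul_ι (x : 𝕆) (z : 𝕆ℂ) : cmul z (ι x) = (omul z.1 x, omul z.2 x) := by
  simp [cmul, ι, omul_zero]

/-- The complexified octonions are alternative with respect to octonionic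
coefficients: `x(xz) = x²z` and `(zx)x = zx²` for `x ∈ 𝕆`, `z ∈ 𝕆_ℂ`. -/
theorem complexified_octonion_alternative (x : 𝕆) (z : 𝕆ℂ) :
    cmul (ι x) (cmul (ι x) z) = cmul (ι (omul x x)) z ∧
    cmul (cmul z (ι x)) (ι x) = cmul z (ι (omul x x)) := by
  simp only [ι_cmul, cmul_ι, omul_omul_self_left, omul_omul_self_right, and_self]
end
end

section
/- Factorization of the Laplacian by the octonionic Cauchy–Riemann operator: if f : 𝕆 → 𝕆 is twice continuously differentiable, then at every point p, ∂_x(∂_x̄ f)(p) = ∂_x̄(∂_x f)(p) = Δf(p), where Δf(p) := Σ_{j=0}^{7} (the second derivative of f at p taken twice in direction e_j). -/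
noncomputable section

open scoped BigOperators

/-- The quaternion unit i. -/
def qi : ℍ := ⟨0, 1, 0, 0⟩
/-- The quaternion unit j. -/
def qj : ℍ := ⟨0, 0, 1, 0⟩
/-- The quaternion unit k. -/
def qk : ℍ := ⟨0, 0, 0, 1⟩

/-- The standard basis e₀,…,e₇ of 𝕆 ≅ ℝ⁸. -/
def e : Fin 8 → 𝕆 :=
  ![(1, 0), (qi, 0), (qj, 0), (qk, 0), (0, 1), (0, qi), (0, qj), (0, qk)]

/-- The octonionic Cauchy–Riemann operator `∂_x f = ∂₀f + Σ_{j=1}^7 e_j * ∂_j f`. -/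
def CR (f : 𝕆 → 𝕆) (p : 𝕆) : 𝕆 :=
  fderiv ℝ f p (e 0) + ∑ j : Fin 7, omul (e j.succ) (fderiv ℝ f p (e j.succ))

/-- The conjugate octonionic Cauchy–Riemann operator
`∂_x̄ f = ∂₀f − Σ_{j=1}^7 e_j * ∂_j f`. -/
def CRbar (f : 𝕆 → 𝕆) (p : 𝕆) : 𝕆 :=
  fderiv ℝ f p (e 0) - ∑ j : Fin 7, omul (e j.succ) (fderiv ℝ f p (e j.succ))

/-- The Euclidean Laplacian: sum of the second derivatives twice in each
basis direction. -/
def lap (f : 𝕆 → 𝕆) (p : 𝕆) : 𝕆 :=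
  ∑ j : Fin 8, fderiv ℝ (fderiv ℝ f) p (e j) (e j)

/-- Left multiplication by an octonion, as a continuous linear map. -/
def omulLeft (a : 𝕆) : 𝕆 →L[ℝ] 𝕆 :=
  LinearMap.toContinuousLinearMap
    { toFun := omul a
      map_add' := fun x y => by
        ext <;> simp [omul] <;> ring
      map_smul' := fun c x => by
        ext <;> simp [omul] <;> ring }

@[simp]
lemma omulLeft_apply (a x : 𝕆) : omulLeft a x = omul a x := rfl

/-- The Euclidean inner product on `𝕆 ≅ ℝ⁸`. -/
def oinner (a b : 𝕆) : ℝ :=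
  (a.1 * star b.1).re + (a.2 * star b.2).re

set_option maxHeartbeats 2000000 in
/-- The Clifford relation for left multiplication by purely imaginary octonions. -/
lemma omul_omul_add_omul_omul {a b : 𝕆} (ha : a.1.re = 0) (hb : b.1.re = 0) (x : 𝕆) :
    omul a (omul b x) + omul b (omul a x) = (-2 * oinner a b) • x := by
  ext <;> simp [omul, oinner, ha, hb] <;> ring

open scoped Quaternion in
lemma e_succ_re (j : Fin 7) : (e j.succ).1.re = 0 := by
  fin_cases j <;> simp [e, qi, qj, qk]

open scoped Quaternion in
lemma oinner_e_succ (i j : Fin 7) :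
    oinner (e i.succ) (e j.succ) = if i = j then 1 else 0 := by
  fin_cases i <;> fin_cases j <;> simp [e, oinner] <;> simp [qi, qj, qk]

/-- Squaring the imaginary part of the Cauchy–Riemann operator on a symmetric Hessian. -/
lemma sum_omul_omul_of_symm (B : 𝕆 →L[ℝ] 𝕆 →L[ℝ] 𝕆) (hB : ∀ v w, B v w = B w v) :
    ∑ i : Fin 7, ∑ j : Fin 7, omul (e i.succ) (omul (e j.succ) (B (e i.succ) (e j.succ))) =
      -∑ i : Fin 7, B (e i.succ) (e i.succ) := by
  set S := ∑ i : Fin 7, ∑ j : Fin 7,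
    omul (e i.succ) (omul (e j.succ) (B (e i.succ) (e j.succ))) with hS
  have hswap : S = ∑ i : Fin 7, ∑ j : Fin 7,
      omul (e j.succ) (omul (e i.succ) (B (e i.succ) (e j.succ))) := by
    rw [hS, Finset.sum_comm]
    simp_rw [hB (e (Fin.succ _)) (e (Fin.succ _))]
  have hdouble : (2 : ℝ) • S = (2 : ℝ) • -∑ i : Fin 7, B (e i.succ) (e i.succ) := by
    rw [two_smul]
    nth_rewrite 2 [hswap]
    simp_rw [hS, ← Finset.sum_add_distrib,
      omul_omul_add_omul_omul (e_succ_re _) (e_succ_re _), oinner_e_succ]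
    simp [ite_smul, Finset.smul_sum]
  exact smul_right_injective 𝕆 (two_ne_zero (α := ℝ)) hdouble

lemma hasFDerivAt_fderiv_apply {f : 𝕆 → 𝕆} (hf : ContDiff ℝ 2 f) (p w : 𝕆) :
    HasFDerivAt (fun q => fderiv ℝ f q w) ((fderiv ℝ (fderiv ℝ f) p).flip w) p := by
  have h : DifferentiableAt ℝ (fderiv ℝ f) p :=
    ((hf.fderiv_right (m := 1) (by norm_num)).differentiable (by norm_num)) p
  exact ((ContinuousLinearMap.apply ℝ 𝕆 w).hasFDerivAt).comp p h.hasFDerivAt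

lemma hasFDerivAt_sum_omul_fderiv {f : 𝕆 → 𝕆} (hf : ContDiff ℝ 2 f) (p : 𝕆) :
    HasFDerivAt (fun q => ∑ j : Fin 7, omul (e j.succ) (fderiv ℝ f q (e j.succ)))
      (∑ j : Fin 7, (omulLeft (e j.succ)).comp
        ((fderiv ℝ (fderiv ℝ f) p).flip (e j.succ))) p :=
  HasFDerivAt.fun_sum fun j _ =>
    (omulLeft (e j.succ)).hasFDerivAt.comp p (hasFDerivAt_fderiv_apply hf p (e j.succ))

lemma fderiv_CR_apply {f : 𝕆 → 𝕆} (hf : ContDiff ℝ 2 f) (p v : 𝕆) :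
    fderiv ℝ (fun q => CR f q) p v = fderiv ℝ (fderiv ℝ f) p v (e 0) +
      ∑ j : Fin 7, omul (e j.succ) (fderiv ℝ (fderiv ℝ f) p v (e j.succ)) := by
  have h := ((hasFDerivAt_fderiv_apply hf p (e 0)).add (hasFDerivAt_sum_omul_fderiv hf p)).fderiv
  change fderiv ℝ (fun q => CR f q) p = _ at h
  simp [h]

lemma fderiv_CRbar_apply {f : 𝕆 → 𝕆} (hf : ContDiff ℝ 2 f) (p v : 𝕆) :
    fderiv ℝ (fun q => CRbar f q) p v = fderiv ℝ (fderiv ℝ f) p v (e 0) -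
      ∑ j : Fin 7, omul (e j.succ) (fderiv ℝ (fderiv ℝ f) p v (e j.succ)) := by
  have h := ((hasFDerivAt_fderiv_apply hf p (e 0)).sub (hasFDerivAt_sum_omul_fderiv hf p)).fderiv
  change fderiv ℝ (fun q => CRbar f q) p = _ at h
  simp [h]

/-- Factorization of the Laplacian by the octonionic Cauchy–Riemann operator:
for `f` twice continuously differentiable, `∂_x ∂_x̄ f = ∂_x̄ ∂_x f = Δ f`. -/
theorem CR_factorizes_laplacian (f : 𝕆 → 𝕆) (hf : ContDiff ℝ 2 f) (p : 𝕆) :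
    CR (fun q => CRbar f q) p = lap f p ∧
    CRbar (fun q => CR f q) p = lap f p := by
  have hsymm : ∀ v w, fderiv ℝ (fderiv ℝ f) p v w = fderiv ℝ (fderiv ℝ f) p w v :=
    hf.contDiffAt.isSymmSndFDerivAt (by simp)
  have hsq := sum_omul_omul_of_symm _ hsymm
  have hcross : ∑ i : Fin 7, omul (e i.succ) (fderiv ℝ (fderiv ℝ f) p (e i.succ) (e 0)) =
      ∑ i : Fin 7, omul (e i.succ) (fderiv ℝ (fderiv ℝ f) p (e 0) (e i.succ)) := by
    simp_rw [hsymm _ (e 0)]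
  have hlap : lap f p = fderiv ℝ (fderiv ℝ f) p (e 0) (e 0) +
      ∑ i : Fin 7, fderiv ℝ (fderiv ℝ f) p (e i.succ) (e i.succ) :=
    Fin.sum_univ_succ _
  simp_rw [← omulLeft_apply] at hsq hcross
  constructor
  · rw [CR, hlap]
    simp_rw [fderiv_CRbar_apply hf, ← omulLeft_apply, map_sub, map_sum,
      Finset.sum_sub_distrib, hsq, hcross]
    abel
  · rw [CRbar, hlap]
    simp_rw [fderiv_CR_apply hf, ← omulLeft_apply, map_add, map_sum,
      Finset.sum_add_distrib, hsq, hcross]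
    abel
end
end

section
/- Fundamental solution of ∂_z² in dimension n = 1 (weak formulation): for every smooth, compactly supported function φ : ℂ → ℂ, one has ∫_{ℂ} E(z) · (∂_z(∂_z φ))(z) dA(z) = φ(0), where E(z) := (conj z)/(4π z) for z ≠ 0 (and E(0) := 0), ∂_z φ(z) := fderiv ℝ φ z 1 + i · fderiv ℝ φ z i, and dA is the Lebesgue (volume) measure on ℂ ≅ ℝ². -/
noncomputable section

open MeasureTheory

/-- The fundamental solution `E(z) = conj(z)/(4π z)` (with `E(0) := 0`). -/
def E (z : ℂ) : ℂ := if z = 0 then 0 else (starRingEnd ℂ) z / (4 * Real.pi * z)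

/-- The operator `∂_z φ = ∂_x φ + i ∂_y φ`, viewing ℂ as the real plane. -/
def dz (φ : ℂ → ℂ) (z : ℂ) : ℂ :=
  fderiv ℝ φ z 1 + Complex.I * fderiv ℝ φ z Complex.I

theorem dz_eq_zero_of_notMem_tsupport {φ : ℂ → ℂ} {z : ℂ} (hz : z ∉ tsupport φ) :
    dz φ z = 0 := by
  have h : fderiv ℝ φ z = 0 := by
    by_contra h
    exact hz (support_fderiv_subset ℝ h)
  simp [dz, h]

theorem HasCompactSupport.dz {φ : ℂ → ℂ} (hφ : HasCompactSupport φ) :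
    HasCompactSupport (dz φ) :=
  HasCompactSupport.intro hφ fun _ => dz_eq_zero_of_notMem_tsupport

theorem ContDiff.dz {φ : ℂ → ℂ} {m n : WithTop ℕ∞} (hφ : ContDiff ℝ n φ) (hmn : m + 1 ≤ n) :
    ContDiff ℝ m (dz φ) := by
  have h := hφ.fderiv_right hmn
  exact (h.clm_apply contDiff_const).add (contDiff_const.mul (h.clm_apply contDiff_const))

theorem dz_conj_mul {ψ : ℂ → ℂ} {z : ℂ} (hψ : DifferentiableAt ℝ ψ z) :
    dz (fun w => (starRingEnd ℂ) w * ψ w) z = 2 * ψ z + (starRingEnd ℂ) z * dz ψ z := by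
  have hc : HasFDerivAt (fun w : ℂ => (starRingEnd ℂ) w) (Complex.conjCLE : ℂ →L[ℝ] ℂ) z :=
    Complex.conjCLE.hasFDerivAt
  have h : fderiv ℝ (fun w => (starRingEnd ℂ) w * ψ w) z = _ := (hc.mul hψ.hasFDerivAt).fderiv
  rw [dz, dz, h]
  simp
  linear_combination (-ψ z) * Complex.I_mul_I

/-- The operator `dz` in the rotating frame `(u, iu)`, for `u` on the unit circle. -/
theorem dz_div_eq (φ : ℂ → ℂ) (z : ℂ) (θ : ℝ) :
    dz φ z / Complex.exp (θ * Complex.I) = fderiv ℝ φ z (Complex.exp (θ * Complex.I)) +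
      Complex.I * fderiv ℝ φ z (Complex.I * Complex.exp (θ * Complex.I)) := by
  have h1 : Complex.exp (θ * Complex.I) = Real.cos θ • (1 : ℂ) + Real.sin θ • Complex.I := by
    simp [Complex.exp_mul_I]
  have h2 : Complex.I * Complex.exp (θ * Complex.I) =
      (-Real.sin θ) • (1 : ℂ) + Real.cos θ • Complex.I := by
    rw [h1]
    simp only [Complex.real_smul]
    push_cast
    linear_combination (Complex.sin θ) * Complex.I_mul_I
  have hsq : (Real.cos θ : ℂ) ^ 2 + (Real.sin θ : ℂ) ^ 2 = 1 := by
    push_cast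
    exact Complex.cos_sq_add_sin_sq θ
  rw [div_eq_iff (Complex.exp_ne_zero _), h2, h1]
  simp only [map_add, map_smul, dz]
  simp only [Complex.real_smul]
  push_cast at hsq ⊢
  generalize fderiv ℝ φ z 1 = a
  generalize fderiv ℝ φ z Complex.I = b
  linear_combination (-(a + Complex.I * b)) * hsq +
    (Complex.sin θ ^ 2 * a - Complex.sin θ * Complex.cos θ * b) * Complex.I_mul_I

theorem integrableOn_polar_apply {L : ℂ → ℂ →L[ℝ] ℂ} (hL : Continuous L)
    (hLs : HasCompactSupport L) {w : ℝ → ℂ} (hw : Continuous w) :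
    IntegrableOn (fun p : ℝ × ℝ => L (p.1 * Complex.exp (p.2 * Complex.I)) (w p.2))
      (Set.Ioi 0 ×ˢ Set.Ioo (-Real.pi) Real.pi) := by
  obtain ⟨R, hR⟩ := hLs.isBounded.subset_closedBall (0 : ℂ)
  have hcont : Continuous fun p : ℝ × ℝ =>
      L (p.1 * Complex.exp (p.2 * Complex.I)) (w p.2) := by fun_prop
  refine (hcont.continuousOn.integrableOn_compact
    (isCompact_Icc.prod isCompact_Icc :
      IsCompact (Set.Icc 0 R ×ˢ Set.Icc (-Real.pi) Real.pi))).of_forall_sdiff_eq_zero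
    (measurableSet_Ioi.prod measurableSet_Ioo) ?_
  rintro ⟨r, θ⟩ ⟨⟨hr, hθ⟩, hp⟩
  have hL0 : L (r * Complex.exp (θ * Complex.I)) = 0 := by
    refine image_eq_zero_of_notMem_tsupport fun hmem => hp ⟨⟨le_of_lt hr, ?_⟩, ?_⟩
    · have := hR hmem
      rw [mem_closedBall_zero_iff, norm_mul, Complex.norm_exp_ofReal_mul_I, mul_one,
        Complex.norm_real] at this
      exact (le_abs_self r).trans this
    · exact Set.Ioo_subset_Icc_self hθ
  simp [hL0]

theorem integral_Ioi_fderiv_ray {φ : ℂ → ℂ} (hφ : ContDiff ℝ 1 φ) (hs : HasCompactSupport φ)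
    {u : ℂ} (hu : u ≠ 0) :
    ∫ r in Set.Ioi (0 : ℝ), fderiv ℝ φ (r * u) u = -φ 0 := by
  have hemb : Topology.IsClosedEmbedding fun r : ℝ => (r : ℂ) * u :=
    (Homeomorph.mulRight₀ u hu).isClosedEmbedding.comp Complex.isometry_ofReal.isClosedEmbedding
  have hray : ContDiff ℝ 1 fun r : ℝ => φ (r * u) :=
    hφ.comp (Complex.ofRealCLM.contDiff.mul contDiff_const)
  have hderiv (r : ℝ) : deriv (fun r : ℝ => φ (r * u)) r = fderiv ℝ φ (r * u) u := by
    have h1 : HasDerivAt (fun r : ℝ => (r : ℂ) * u) u r := by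
      simpa using (Complex.ofRealCLM.hasDerivAt (x := r)).mul_const u
    exact ((hφ.differentiable one_ne_zero _).hasFDerivAt.comp_hasDerivAt r h1).deriv
  have := HasCompactSupport.integral_Ioi_deriv_eq hray (hs.comp_isClosedEmbedding hemb) 0
  simpa [hderiv] using this

theorem integral_Ioo_fderiv_circle {φ : ℂ → ℂ} (hφ : ContDiff ℝ 1 φ) {r : ℝ} (hr : r ≠ 0) :
    ∫ θ in Set.Ioo (-Real.pi) Real.pi, fderiv ℝ φ (r * Complex.exp (θ * Complex.I))
      (Complex.I * Complex.exp (θ * Complex.I)) = 0 := by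
  have hderiv (θ : ℝ) : HasDerivAt
      (fun θ : ℝ => (r : ℂ)⁻¹ * φ (r * Complex.exp (θ * Complex.I)))
      (fderiv ℝ φ (r * Complex.exp (θ * Complex.I))
        (Complex.I * Complex.exp (θ * Complex.I))) θ := by
    have h1 : HasDerivAt (fun θ : ℝ => (r : ℂ) * Complex.exp (θ * Complex.I))
        (r • (Complex.I * Complex.exp (θ * Complex.I))) θ := by
      have h0 : HasDerivAt (fun θ : ℝ => (θ : ℂ) * Complex.I) Complex.I θ := by
        simpa using (Complex.ofRealCLM.hasDerivAt (x := θ)).mul_const Complex.I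
      rw [Complex.real_smul, mul_comm Complex.I]
      exact h0.cexp.const_mul (r : ℂ)
    have h2 := ((hφ.differentiable one_ne_zero _).hasFDerivAt.comp_hasDerivAt θ h1).const_mul
      (r : ℂ)⁻¹
    rw [map_smul, Complex.real_smul, inv_mul_cancel_left₀ (Complex.ofReal_ne_zero.2 hr)] at h2
    exact h2
  have hcont : Continuous fun θ : ℝ => fderiv ℝ φ (r * Complex.exp (θ * Complex.I))
      (Complex.I * Complex.exp (θ * Complex.I)) := by
    have := hφ.continuous_fderiv one_ne_zero
    fun_prop
  rw [← integral_Ioc_eq_integral_Ioo,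
    ← intervalIntegral.integral_of_le (by linarith [Real.pi_pos]),
    intervalIntegral.integral_eq_sub_of_hasDerivAt (fun θ _ => hderiv θ)
      (hcont.intervalIntegrable _ _)]
  simp [Complex.exp_neg]

/-- **Cauchy–Pompeiu formula** at the origin for compactly supported functions. -/
theorem integral_dz_div {φ : ℂ → ℂ} (hφ : ContDiff ℝ 1 φ) (hs : HasCompactSupport φ) :
    ∫ z : ℂ, dz φ z / z = -(2 * Real.pi) * φ 0 := by
  have hD : Continuous (fderiv ℝ φ) := hφ.continuous_fderiv one_ne_zero
  have hDs : HasCompactSupport (fderiv ℝ φ) := hs.fderiv ℝ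
  have hA := integrableOn_polar_apply hD hDs
    (w := fun θ => Complex.exp (θ * Complex.I)) (by fun_prop)
  have hB := integrableOn_polar_apply hD hDs
    (w := fun θ => Complex.I * Complex.exp (θ * Complex.I)) (by fun_prop)
  have hmeas : MeasurableSet (Set.Ioi (0 : ℝ) ×ˢ Set.Ioo (-Real.pi) Real.pi) :=
    measurableSet_Ioi.prod measurableSet_Ioo
  have hpolar : ∫ z : ℂ, dz φ z / z =
      ∫ p in Set.Ioi (0 : ℝ) ×ˢ Set.Ioo (-Real.pi) Real.pi,
        (fderiv ℝ φ (p.1 * Complex.exp (p.2 * Complex.I)) (Complex.exp (p.2 * Complex.I)) +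
        Complex.I * fderiv ℝ φ (p.1 * Complex.exp (p.2 * Complex.I))
          (Complex.I * Complex.exp (p.2 * Complex.I))) := by
    rw [← Complex.integral_comp_polarCoord_symm, polarCoord_target]
    refine setIntegral_congr_fun hmeas fun p hp => ?_
    have hp0 : (p.1 : ℂ) ≠ 0 := Complex.ofReal_ne_zero.2 (ne_of_gt hp.1)
    have hsymm : Complex.polarCoord.symm p = p.1 * Complex.exp (p.2 * Complex.I) := by
      simp [Complex.exp_mul_I]
    simp only [hsymm, Complex.real_smul]
    rw [← dz_div_eq]
    field_simp
  rw [hpolar, integral_add hA (hB.const_mul _), integral_const_mul]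
  have hradial : ∫ p in Set.Ioi (0 : ℝ) ×ˢ Set.Ioo (-Real.pi) Real.pi,
      fderiv ℝ φ (p.1 * Complex.exp (p.2 * Complex.I)) (Complex.exp (p.2 * Complex.I)) =
        -(2 * Real.pi) * φ 0 := by
    rw [IntegrableOn, Measure.volume_eq_prod, ← Measure.prod_restrict] at hA
    rw [Measure.volume_eq_prod, ← Measure.prod_restrict, integral_prod_symm _ hA]
    simp only [integral_Ioi_fderiv_ray hφ hs (Complex.exp_ne_zero _)]
    rw [setIntegral_const, Real.volume_real_Ioo_of_le (by linarith [Real.pi_pos]),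
      Complex.real_smul]
    push_cast
    ring
  have hangular : ∫ p in Set.Ioi (0 : ℝ) ×ˢ Set.Ioo (-Real.pi) Real.pi,
      fderiv ℝ φ (p.1 * Complex.exp (p.2 * Complex.I))
        (Complex.I * Complex.exp (p.2 * Complex.I)) = 0 := by
    rw [Measure.volume_eq_prod] at hB ⊢
    rw [setIntegral_prod _ hB]
    exact setIntegral_eq_zero_of_forall_eq_zero fun r hr =>
      integral_Ioo_fderiv_circle hφ (ne_of_gt hr)
  rw [hradial, hangular, mul_zero, add_zero]

theorem integrable_div_id {ψ : ℂ → ℂ} (hψ : Continuous ψ) (hs : HasCompactSupport ψ) :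
    Integrable fun z : ℂ => ψ z / z := by
  have hinv : LocallyIntegrable (fun z : ℂ => z⁻¹) := by
    refine locallyIntegrable_of_norm_le_rpow (C := 1) (α := 1) ?_ ?_ ?_ ?_
    · simp
    · simp
    · exact .of_forall fun z => by simp [Real.rpow_neg_one]
    · exact measurable_inv.aestronglyMeasurable
  simpa [div_eq_mul_inv] using hinv.integrable_smul_left_of_hasCompactSupport hψ hs

/-- Weak formulation of the fundamental solution of `∂_z²` in dimension `n = 1`:
for every smooth compactly supported `φ : ℂ → ℂ`,
`∫ E(z) · (∂_z² φ)(z) dA(z) = φ(0)`. -/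
theorem fundamental_solution_dim_one (φ : ℂ → ℂ)
    (hφ : ContDiff ℝ (⊤ : ℕ∞) φ) (hsupp : HasCompactSupport φ) :
    ∫ z : ℂ, E z * dz (fun w => dz φ w) z = φ 0 := by
  set ψ := dz φ
  have hψ : ContDiff ℝ 1 ψ := hφ.dz (WithTop.coe_le_coe.2 (le_top : (1 + 1 : ℕ∞) ≤ ⊤))
  have hψs : HasCompactSupport ψ := hsupp.dz
  have hconjψ : ContDiff ℝ 1 fun w => (starRingEnd ℂ) w * ψ w :=
    Complex.conjCLE.contDiff.mul hψ
  have hfirst := integral_dz_div (hφ.of_le (by exact_mod_cast le_top)) hsupp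
  have hsecond := integral_dz_div hconjψ hψs.mul_left
  have hE (z : ℂ) : E z * dz ψ z = (4 * Real.pi : ℂ)⁻¹ *
      (dz (fun w => (starRingEnd ℂ) w * ψ w) z / z - 2 * (ψ z / z)) := by
    rw [dz_conj_mul (hψ.differentiable one_ne_zero z), E]
    split_ifs with hz
    · simp [hz]
    · have : (Real.pi : ℂ) ≠ 0 := Complex.ofReal_ne_zero.2 Real.pi_ne_zero
      field_simp
      ring
  have hint1 : Integrable fun z => dz (fun w => (starRingEnd ℂ) w * ψ w) z / z :=
    integrable_div_id (hconjψ.dz (m := 0) (by simp)).continuous (HasCompactSupport.dz hψs.mul_left)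
  have hint2 : Integrable fun z => 2 * (ψ z / z) :=
    (integrable_div_id hψ.continuous hψs).const_mul 2
  change ∫ z : ℂ, E z * dz ψ z = φ 0
  simp only [hE]
  rw [integral_const_mul, integral_sub hint1 hint2, integral_const_mul, hsecond, hfirst]
  have : (Real.pi : ℂ) ≠ 0 := Complex.ofReal_ne_zero.2 Real.pi_ne_zero
  simp
  field_simp
  ring
end
end

section
/- Existence of the principal value integral defining the singular part of the fundamental solution: let n ≥ 1, let φ : ℝⁿ × ℝⁿ → ℂ be a Schwartz function, and let ω, ν ∈ ℝⁿ be unit vectors with ⟨ω, ν⟩ = 0. Then there exists J ∈ ℂ such that the function a ↦ ∫_{R ∈ [1/a, a]} ∫_{θ ∈ (0, π/2), |π/4 − θ| ≥ 1/a} R^{2n−3} · (cos θ · sin θ)^{n−1} / (sin²θ − cos²θ) · φ(R cos θ • ω, R sin θ • ν) dθ dR tends to J as a → ∞. -/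
noncomputable section

open MeasureTheory Real Filter
open scoped RealInnerProductSpace

/-- Folding the integral of an integrable function at the origin. -/
lemma integral_eq_integral_Ioi_add_neg {g : ℝ → ℂ} (hg : Integrable g) :
    ∫ t, g t = ∫ t in Set.Ioi 0, (g t + g (-t)) := by
  rw [integral_add hg.integrableOn hg.comp_neg.integrableOn, integral_comp_neg_Ioi, neg_zero,
    add_comm, intervalIntegral.integral_Iic_add_Ioi hg.integrableOn hg.integrableOn]

/-- An integral over an interval with a symmetric gap around its centre `c`, folded at `c`. -/
lemma setIntegral_symmetric_gap {f : ℝ → ℂ} {c d ε : ℝ}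
    (hf : IntegrableOn f {θ | θ ∈ Set.Ioo (c - d) (c + d) ∧ ε ≤ |c - θ|}) :
    ∫ θ in {θ | θ ∈ Set.Ioo (c - d) (c + d) ∧ ε ≤ |c - θ|}, f θ =
      ∫ t in Set.Ioo 0 d, (Set.Ici ε).indicator (fun t => f (c + t) + f (c - t)) t := by
  have hS : MeasurableSet {θ | θ ∈ Set.Ioo (c - d) (c + d) ∧ ε ≤ |c - θ|} :=
    measurableSet_Ioo.inter (measurableSet_le measurable_const (measurable_id.const_sub c).abs)
  set S := {θ | θ ∈ Set.Ioo (c - d) (c + d) ∧ ε ≤ |c - θ|} with hSdef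
  have hi : Integrable (S.indicator f) := (integrable_indicator_iff hS).2 hf
  rw [← integral_indicator hS, ← integral_add_left_eq_self _ c,
    integral_eq_integral_Ioi_add_neg (hi.comp_add_left c), ← integral_indicator measurableSet_Ioi,
    ← integral_indicator measurableSet_Ioo]
  congr 1 with t
  by_cases ht : 0 < t
  · have h1 : c + t ∈ S ↔ t < d ∧ ε ≤ t := by
      simp only [hSdef, Set.mem_ofPred_eq, Set.mem_Ioo, sub_add_cancel_left, abs_neg, abs_of_pos ht]
      constructor
      · rintro ⟨⟨-, h⟩, h'⟩; exact ⟨by linarith, h'⟩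
      · rintro ⟨h, h'⟩; exact ⟨⟨by linarith, by linarith⟩, h'⟩
    have h2 : c + -t ∈ S ↔ t < d ∧ ε ≤ t := by
      simp only [hSdef, Set.mem_ofPred_eq, Set.mem_Ioo, ← sub_eq_add_neg, sub_sub_cancel,
        abs_of_pos ht]
      constructor
      · rintro ⟨⟨h, -⟩, h'⟩; exact ⟨by linarith, h'⟩
      · rintro ⟨h, h'⟩; exact ⟨⟨by linarith, by linarith⟩, h'⟩
    by_cases hd : t < d <;> by_cases he : ε ≤ t <;>
      simp [Set.indicator, h1, h2, ht, hd, he, sub_eq_add_neg]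
  · simp [Set.indicator, ht]

/-- A principal value in the inner variable, combined with an improper outer integral, exists
as soon as the folded integrand is dominated by an integrable function of the outer variable. -/
lemma exists_tendsto_integral_symmetric_gap {f : ℝ → ℝ → ℂ} {c d : ℝ} (hd : 0 ≤ d)
    (hf : Measurable (Function.uncurry f))
    (hint : ∀ R, ∀ ε > 0,
      IntegrableOn (f R) {θ | θ ∈ Set.Ioo (c - d) (c + d) ∧ ε ≤ |c - θ|})
    {g : ℝ → ℝ} (hg : IntegrableOn g (Set.Ioi 0))
    (hbound : ∀ R > 0, ∀ t ∈ Set.Ioo 0 d, ‖f R (c + t) + f R (c - t)‖ ≤ g R) :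
    ∃ J : ℂ, Tendsto
      (fun a : ℝ => ∫ R in Set.Icc (1 / a) a,
        ∫ θ in {θ | θ ∈ Set.Ioo (c - d) (c + d) ∧ 1 / a ≤ |c - θ|}, f R θ)
      atTop (nhds J) := by
  set K : ℝ → ℝ → ℂ := fun R t => f R (c + t) + f R (c - t) with hK
  have hKm : Measurable (Function.uncurry K) :=
    (hf.comp (measurable_fst.prodMk (measurable_snd.const_add c))).add
      (hf.comp (measurable_fst.prodMk (measurable_snd.const_sub c)))
  set I : ℝ → ℝ → ℂ := fun a R => ∫ t in Set.Ioo 0 d, (Set.Ici (1 / a)).indicator (K R) t with hI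
  have hKb : ∀ a, ∀ R > 0, ∀ t ∈ Set.Ioo 0 d, ‖(Set.Ici (1 / a)).indicator (K R) t‖ ≤ g R :=
    fun a R hR t ht => (norm_indicator_le_norm_self _ _).trans (hbound R hR t ht)
  have hIb : ∀ a, ∀ R > 0, ‖I a R‖ ≤ g R * d := fun a R hR => by
    have h := norm_setIntegral_le_of_norm_le_const (μ := volume) (s := Set.Ioo 0 d)
      (by simp) (hKb a R hR)
    rwa [Real.volume_real_Ioo_of_le hd, sub_zero] at h
  have hIm : ∀ a, StronglyMeasurable (I a) := fun a => by
    refine StronglyMeasurable.integral_prod_right (f := fun R => (Set.Ici (1 / a)).indicator (K R))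
      (Measurable.stronglyMeasurable ?_)
    exact hKm.indicator (measurable_snd measurableSet_Ici)
  have hIlim : ∀ R > 0, Tendsto (fun a => I a R) atTop (nhds (∫ t in Set.Ioo 0 d, K R t)) := by
    intro R hR
    refine tendsto_integral_filter_of_dominated_convergence (fun _ => g R) ?_ ?_ ?_ ?_
    · exact Eventually.of_forall fun a =>
        ((hKm.comp measurable_prodMk_left).indicator measurableSet_Ici).aestronglyMeasurable
    · exact Eventually.of_forall fun a =>
        (ae_restrict_iff' measurableSet_Ioo).2 (Eventually.of_forall (hKb a R hR))
    · exact integrableOn_const (by simp)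
    · refine (ae_restrict_iff' measurableSet_Ioo).2 (Eventually.of_forall fun t ht => ?_)
      refine tendsto_const_nhds.congr' ?_
      filter_upwards [eventually_ge_atTop (1 / t)] with a ha
      rw [Set.indicator_of_mem]
      exact (one_div_le (lt_of_lt_of_le (one_div_pos.2 ht.1) ha) ht.1).2 ha
  refine ⟨∫ R in Set.Ioi 0, ∫ t in Set.Ioo 0 d, K R t, ?_⟩
  have key : Tendsto (fun a => ∫ R in Set.Ioi 0, (Set.Icc (1 / a) a).indicator (I a) R) atTop
      (nhds (∫ R in Set.Ioi 0, ∫ t in Set.Ioo 0 d, K R t)) := by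
    refine tendsto_integral_filter_of_dominated_convergence (fun R => g R * d) ?_ ?_
      (hg.mul_const d) ?_
    · exact Eventually.of_forall fun a =>
        ((hIm a).indicator measurableSet_Icc).aestronglyMeasurable
    · exact Eventually.of_forall fun a => (ae_restrict_iff' measurableSet_Ioi).2
        (Eventually.of_forall fun R hR =>
          (norm_indicator_le_norm_self _ _).trans (hIb a R hR))
    · refine (ae_restrict_iff' measurableSet_Ioi).2 (Eventually.of_forall fun R hR => ?_)
      refine (hIlim R hR).congr' ?_
      filter_upwards [eventually_ge_atTop (1 / R), eventually_ge_atTop R] with a ha ha'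
      rw [Set.indicator_of_mem]
      exact ⟨(one_div_le (lt_of_lt_of_le hR ha') hR).2 ha, ha'⟩
  refine key.congr' ?_
  filter_upwards [eventually_gt_atTop 0] with a ha
  have hsub : Set.Icc (1 / a) a ⊆ Set.Ioi 0 := fun R hR => (one_div_pos.2 ha).trans_le hR.1
  rw [setIntegral_indicator measurableSet_Icc, Set.inter_eq_self_of_subset_right hsub]
  refine integral_congr_ae (Eventually.of_forall fun R => ?_)
  exact (setIntegral_symmetric_gap (hint R _ (one_div_pos.2 ha))).symm

section

variable {E F G : Type*} [NormedAddCommGroup E] [NormedSpace ℝ E] [NormedAddCommGroup F]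
  [NormedSpace ℝ F] [NormedAddCommGroup G] [NormedSpace ℝ G]

/-- The derivative of a Schwartz function decays rapidly. -/
lemma SchwartzMap.exists_one_add_norm_pow_mul_norm_fderiv_le (φ : SchwartzMap E G) (k : ℕ) :
    ∃ C, ∀ x, (1 + ‖x‖) ^ k * ‖fderiv ℝ φ x‖ ≤ C := by
  refine ⟨2 ^ k * (Finset.Iic (k, 1)).sup (fun m => SchwartzMap.seminorm ℝ m.1 m.2) φ,
    fun x => ?_⟩
  rw [← norm_iteratedFDeriv_one]
  exact SchwartzMap.one_add_le_sup_seminorm_apply (m := (k, 1)) le_rfl le_rfl φ x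

/-- Half the radius bounds the sup norm of a point in polar coordinates from below. -/
lemma half_le_norm_polar {ω : E} {ν : F} (hω : ‖ω‖ = 1) (hν : ‖ν‖ = 1) {R : ℝ} (hR : 0 ≤ R)
    (θ : ℝ) : R / 2 ≤ ‖((R * cos θ) • ω, (R * sin θ) • ν)‖ := by
  have h : 1 / 2 ≤ max |cos θ| |sin θ| := by
    by_contra! h
    obtain ⟨h1, h2⟩ := max_lt_iff.1 h
    nlinarith [cos_sq_add_sin_sq θ, sq_abs (cos θ), sq_abs (sin θ), abs_nonneg (cos θ),
      abs_nonneg (sin θ)]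
  rw [Prod.norm_def]
  simp only [norm_smul, hω, hν, norm_mul, Real.norm_eq_abs, abs_of_nonneg hR, mul_one]
  rw [← mul_max_of_nonneg _ _ hR]
  nlinarith

/-- Angular Lipschitz estimate, with decay in the radius, for a Schwartz function in polar
coordinates. -/
lemma SchwartzMap.exists_norm_polar_sub_le (φ : SchwartzMap (E × F) G) {ω : E} {ν : F}
    (hω : ‖ω‖ = 1) (hν : ‖ν‖ = 1) (k : ℕ) :
    ∃ C, ∀ R : ℝ, 0 ≤ R → ∀ θ₁ θ₂ : ℝ,
      R ^ k * ‖φ ((R * cos θ₂) • ω, (R * sin θ₂) • ν) - φ ((R * cos θ₁) • ω, (R * sin θ₁) • ν)‖ ≤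
        C * (1 + R ^ 2)⁻¹ * |θ₂ - θ₁| := by
  obtain ⟨C, hC⟩ := φ.exists_one_add_norm_pow_mul_norm_fderiv_le (k + 3)
  refine ⟨2 ^ (k + 3) * C, fun R hR θ₁ θ₂ => ?_⟩
  have hpos : 0 < 1 + R ^ 2 := by positivity
  set P : ℝ → E × F := fun θ => ((R * cos θ) • ω, (R * sin θ) • ν) with hP
  have hderiv : ∀ θ, HasDerivAt P ((R * -sin θ) • ω, (R * cos θ) • ν) θ := fun θ =>
    (((hasDerivAt_cos θ).const_mul R).smul_const ω).prodMk
      (((hasDerivAt_sin θ).const_mul R).smul_const ν)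
  have hnorm : ∀ θ, ‖((R * -sin θ) • ω, (R * cos θ) • ν)‖ ≤ R := fun θ => by
    rw [Prod.norm_def]
    simp only [norm_smul, hω, hν, norm_mul, Real.norm_eq_abs, abs_of_nonneg hR, mul_one, abs_neg]
    exact max_le (mul_le_of_le_one_right hR (abs_sin_le_one θ))
      (mul_le_of_le_one_right hR (abs_cos_le_one θ))
  have hweight : ∀ θ, (1 + R ^ 2) * R ^ (k + 1) * ‖fderiv ℝ φ (P θ)‖ ≤ 2 ^ (k + 3) * C := fun θ => by
    have h := half_le_norm_polar hω hν hR θ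
    have h1 : R ≤ 2 * (1 + ‖P θ‖) := by linarith
    have h2 : 1 + R ^ 2 ≤ (2 * (1 + ‖P θ‖)) ^ 2 := by
      have : 0 ≤ ‖P θ‖ := norm_nonneg _
      nlinarith
    calc (1 + R ^ 2) * R ^ (k + 1) * ‖fderiv ℝ φ (P θ)‖
        ≤ (2 * (1 + ‖P θ‖)) ^ 2 * (2 * (1 + ‖P θ‖)) ^ (k + 1) * ‖fderiv ℝ φ (P θ)‖ := by gcongr
      _ = 2 ^ (k + 3) * ((1 + ‖P θ‖) ^ (k + 3) * ‖fderiv ℝ φ (P θ)‖) := by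
        rw [mul_pow, mul_pow]; ring
      _ ≤ 2 ^ (k + 3) * C := by gcongr; exact hC _
  have hφ : ∀ θ, HasDerivAt (fun θ => R ^ k • φ (P θ))
      (R ^ k • fderiv ℝ φ (P θ) ((R * -sin θ) • ω, (R * cos θ) • ν)) θ := fun θ =>
    (φ.differentiableAt.hasFDerivAt.comp_hasDerivAt θ (hderiv θ)).const_smul (R ^ k)
  have hb : ∀ θ, ‖R ^ k • fderiv ℝ φ (P θ) ((R * -sin θ) • ω, (R * cos θ) • ν)‖ ≤
      2 ^ (k + 3) * C * (1 + R ^ 2)⁻¹ := fun θ => by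
    rw [norm_smul, norm_pow, Real.norm_of_nonneg hR, ← div_eq_mul_inv, le_div_iff₀ hpos]
    calc R ^ k * ‖fderiv ℝ φ (P θ) ((R * -sin θ) • ω, (R * cos θ) • ν)‖ * (1 + R ^ 2)
        ≤ R ^ k * (‖fderiv ℝ φ (P θ)‖ * R) * (1 + R ^ 2) := by
          gcongr
          exact (ContinuousLinearMap.le_opNorm _ _).trans
            (mul_le_mul_of_nonneg_left (hnorm θ) (norm_nonneg _))
      _ = (1 + R ^ 2) * R ^ (k + 1) * ‖fderiv ℝ φ (P θ)‖ := by ring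
      _ ≤ 2 ^ (k + 3) * C := hweight θ
  have := convex_univ.norm_image_sub_le_of_norm_hasDerivWithin_le
    (fun θ _ => (hφ θ).hasDerivWithinAt) (fun θ _ => hb θ) (Set.mem_univ θ₁) (Set.mem_univ θ₂)
  rwa [← smul_sub, norm_smul, norm_pow, Real.norm_of_nonneg hR, Real.norm_eq_abs] at this

end

lemma sin_sq_sub_cos_sq_pi_div_four_add (t : ℝ) :
    sin (π / 4 + t) ^ 2 - cos (π / 4 + t) ^ 2 = sin (2 * t) := by
  rw [← neg_sub, ← cos_two_mul', show 2 * (π / 4 + t) = 2 * t + π / 2 by ring, cos_add_pi_div_two,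
    neg_neg]

lemma two_mul_cos_mul_sin_pi_div_four_add (t : ℝ) :
    cos (π / 4 + t) * sin (π / 4 + t) = cos (2 * t) / 2 := by
  have h : sin (2 * (π / 4 + t)) = cos (2 * t) := by
    rw [show 2 * (π / 4 + t) = 2 * t + π / 2 by ring, sin_add_pi_div_two]
  rw [← h, sin_two_mul]; ring

/-- The angular kernel is odd about `π / 4`, with a simple pole there. -/
lemma angular_kernel_odd (m : ℕ) (t : ℝ) :
    (cos (π / 4 - t) * sin (π / 4 - t)) ^ m / (sin (π / 4 - t) ^ 2 - cos (π / 4 - t) ^ 2) =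
      -((cos (π / 4 + t) * sin (π / 4 + t)) ^ m /
        (sin (π / 4 + t) ^ 2 - cos (π / 4 + t) ^ 2)) := by
  rw [sub_eq_add_neg, two_mul_cos_mul_sin_pi_div_four_add, sin_sq_sub_cos_sq_pi_div_four_add,
    two_mul_cos_mul_sin_pi_div_four_add, sin_sq_sub_cos_sq_pi_div_four_add, mul_neg, cos_neg,
    sin_neg, div_neg]

lemma abs_angular_kernel_le (m : ℕ) {t : ℝ} (ht : t ∈ Set.Ioo 0 (π / 4)) :
    |(cos (π / 4 + t) * sin (π / 4 + t)) ^ m /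
      (sin (π / 4 + t) ^ 2 - cos (π / 4 + t) ^ 2)| ≤ 1 / t := by
  rw [two_mul_cos_mul_sin_pi_div_four_add, sin_sq_sub_cos_sq_pi_div_four_add, abs_div, abs_pow]
  have h1 : |cos (2 * t) / 2| ^ m ≤ 1 := by
    refine pow_le_one₀ (abs_nonneg _) ?_
    rw [abs_div, abs_two]
    linarith [abs_cos_le_one (2 * t)]
  have h2 : t ≤ sin (2 * t) := by
    have h := mul_le_sin (x := 2 * t) (by linarith [ht.1]) (by linarith [ht.2])
    have : 1 / 2 ≤ 2 / π := by
      rw [div_le_div_iff₀ two_pos pi_pos]; linarith [pi_le_four]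
    nlinarith [ht.1]
  have h3 : t ≤ |sin (2 * t)| := h2.trans (le_abs_self _)
  exact div_le_div₀ zero_le_one h1 ht.1 h3

/-- Existence of the principal value integral defining the singular part `I₂` of
the fundamental solution of the ultrahyperbolic operator, written in polar
coordinates `r = R cos θ`, `ρ = R sin θ`: for a Schwartz function `φ` and
orthogonal unit vectors `ω, ν`, the truncated integrals converge as `a → ∞`. -/
theorem principal_value_exists (n : ℕ) (hn : 1 ≤ n)
    (φ : SchwartzMap (EuclideanSpace ℝ (Fin n) × EuclideanSpace ℝ (Fin n)) ℂ)
    (ω ν : EuclideanSpace ℝ (Fin n)) (hω : ‖ω‖ = 1) (hν : ‖ν‖ = 1)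
    (hortho : ⟪ω, ν⟫ = 0) :
    ∃ J : ℂ, Tendsto
      (fun a : ℝ =>
        ∫ R in Set.Icc (1 / a) a,
          ∫ θ in {θ : ℝ | θ ∈ Set.Ioo 0 (π / 2) ∧ 1 / a ≤ |π / 4 - θ|},
            ((R ^ (2 * (n : ℤ) - 3) * (Real.cos θ * Real.sin θ) ^ (n - 1) /
                (Real.sin θ ^ 2 - Real.cos θ ^ 2) : ℝ) : ℂ) *
              φ ((R * Real.cos θ) • ω, (R * Real.sin θ) • ν))
      atTop (nhds J) := by
  have hn2 : 2 ≤ n := by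
    have hli : LinearIndependent ℝ ![ω, ν] := by
      refine Orthonormal.linearIndependent ?_
      rw [orthonormal_iff_ite]
      intro i j
      fin_cases i <;> fin_cases j <;>
        simp [hω, hν, hortho, real_inner_comm]
    simpa using hli.fintype_card_le_finrank
  obtain ⟨k, rfl⟩ := Nat.exists_eq_add_of_le' hn2
  obtain ⟨C, hC⟩ := φ.exists_norm_polar_sub_le hω hν (2 * k + 1)
  have hset : Set.Ioo (0 : ℝ) (π / 2) = Set.Ioo (π / 4 - π / 4) (π / 4 + π / 4) := by
    congr 1 <;> ring
  have hexp : 2 * ((k + 2 : ℕ) : ℤ) - 3 = ((2 * k + 1 : ℕ) : ℤ) := by push_cast; ring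
  simp only [hset, hexp, zpow_natCast]
  have hcont : Continuous fun p : ℝ × ℝ =>
      φ ((p.1 * cos p.2) • ω, (p.1 * sin p.2) • ν) := φ.continuous.comp (by fun_prop)
  refine exists_tendsto_integral_symmetric_gap (by positivity) ?_ ?_
    (g := fun R => 2 * C * (1 + R ^ 2)⁻¹)
    (integrable_inv_one_add_sq.const_mul _).integrableOn ?_
  · exact Measurable.mul (by fun_prop) hcont.measurable
  · intro R ε hε
    refine IntegrableOn.mono_set (t := Set.Icc (π / 4 - π / 4) (π / 4 + π / 4) ∩
      {θ | ε ≤ |π / 4 - θ|}) (ContinuousOn.integrableOn_compact (isCompact_Icc.inter_right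
        (isClosed_le continuous_const (by fun_prop))) ?_)
      (fun θ hθ => ⟨Set.Ioo_subset_Icc_self hθ.1, hθ.2⟩)
    refine ContinuousOn.mul (Complex.continuous_ofReal.comp_continuousOn
      (ContinuousOn.div (by fun_prop) (by fun_prop) fun θ hθ => ?_))
      (hcont.comp (Continuous.prodMk_right R)).continuousOn
    obtain ⟨⟨h1, h2⟩, h3⟩ := hθ
    rw [← add_sub_cancel (π / 4) θ, sin_sq_sub_cos_sq_pi_div_four_add, Ne,
      sin_eq_zero_iff_of_lt_of_lt (by linarith [pi_pos]) (by linarith [pi_pos])]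
    intro h0
    rw [Set.mem_ofPred_eq, show π / 4 - θ = 0 by linarith, abs_zero] at h3
    exact hε.not_ge h3
  · intro R hR t ht
    have hker := abs_angular_kernel_le (k + 2 - 1) ht
    have hodd := angular_kernel_odd (k + 2 - 1) t
    simp only [mul_div_assoc]
    rw [hodd]
    set q := (cos (π / 4 + t) * sin (π / 4 + t)) ^ (k + 2 - 1) /
      (sin (π / 4 + t) ^ 2 - cos (π / 4 + t) ^ 2)
    have hdiff := hC R hR.le (π / 4 - t) (π / 4 + t)
    set u := φ ((R * cos (π / 4 + t)) • ω, (R * sin (π / 4 + t)) • ν)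
    set v := φ ((R * cos (π / 4 - t)) • ω, (R * sin (π / 4 - t)) • ν)
    rw [show π / 4 + t - (π / 4 - t) = 2 * t by ring, abs_of_pos (by linarith [ht.1])] at hdiff
    calc ‖((R ^ (2 * k + 1) * q : ℝ) : ℂ) * u + ((R ^ (2 * k + 1) * -q : ℝ) : ℂ) * v‖
        = ‖((R ^ (2 * k + 1) * q : ℝ) : ℂ) * (u - v)‖ := by
          congr 1; push_cast; ring
      _ = |q| * (R ^ (2 * k + 1) * ‖u - v‖) := by
          rw [norm_mul, Complex.norm_real, norm_mul, norm_pow, Real.norm_of_nonneg hR.le,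
            Real.norm_eq_abs]
          ring
      _ ≤ 1 / t * (C * (1 + R ^ 2)⁻¹ * (2 * t)) :=
          mul_le_mul hker hdiff (by positivity) (one_div_pos.2 ht.1).le
      _ = 2 * C * (1 + R ^ 2)⁻¹ := by
          have := ht.1.ne'
          field_simp
end
end
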